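/- Let N be a compact metric space, let M₁ be a metric space, and equip N × M₁ with the ℓ² product distance (WithLp 2 (N × M₁)). Let γ : ℝ → N × M₁ be a geodesic ray for this distance, i.e. √(dist(γ₁ s, γ₁ t)² + dist(γ₂ s, γ₂ t)²) = |s − t| for all s, t ≥ 0, where γ s = (γ₁ s, γ₂ s). Then the first component is constant on [0, ∞) (γ₁ s = γ₁ 0 for all s ≥ 0) and the second component is a geodesic ray in M₁ (dist(γ₂ s, γ₂ t) = |s − t| for all s, t ≥ 0). -/

import Mathlib

theorem WithLp.dist_sq_eq_of_L2 {α β : Type*} [PseudoMetricSpace α] [PseudoMetricSpace β]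
    (x y : WithLp 2 (α × β)) :
    dist x y ^ 2 = dist x.fst y.fst ^ 2 + dist x.snd y.snd ^ 2 := by
  rw [WithLp.prod_dist_eq_add (by norm_num)]
  norm_num [← Real.sqrt_eq_rpow]
  exact Real.sq_sqrt (by positivity)

/-- Equality case of Minkowski's inequality in the plane. -/
theorem mul_eq_mul_of_minkowski_eq {p q a₁ a₂ a₃ b₁ b₂ b₃ : ℝ} (hp : 0 ≤ p) (hq : 0 ≤ q)
    (ha₃ : 0 ≤ a₃) (hb₃ : 0 ≤ b₃) (ha : a₃ ≤ a₁ + a₂) (hb : b₃ ≤ b₁ + b₂)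
    (h₁ : p ^ 2 = a₁ ^ 2 + b₁ ^ 2) (h₂ : q ^ 2 = a₂ ^ 2 + b₂ ^ 2)
    (h₃ : (p + q) ^ 2 = a₃ ^ 2 + b₃ ^ 2) : q * a₁ = p * a₂ := by
  have ha' : a₃ ^ 2 ≤ (a₁ + a₂) ^ 2 := pow_le_pow_left₀ ha₃ ha 2
  have hb' : b₃ ^ 2 ≤ (b₁ + b₂) ^ 2 := pow_le_pow_left₀ hb₃ hb 2
  have hpq : p * q ≤ a₁ * a₂ + b₁ * b₂ := by linarith
  have hmul := mul_le_mul_of_nonneg_left hpq (mul_nonneg hp hq)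
  have hsum : (q * a₁ - p * a₂) ^ 2 + (q * b₁ - p * b₂) ^ 2
      = 2 * (p * q * (p * q)) - 2 * (p * q * (a₁ * a₂ + b₁ * b₂)) := by
    linear_combination (-q ^ 2) * h₁ - p ^ 2 * h₂
  have hsq : (q * a₁ - p * a₂) ^ 2 = 0 :=
    le_antisymm (by linarith [sq_nonneg (q * b₁ - p * b₂)]) (sq_nonneg _)
  exact sub_eq_zero.mp (pow_eq_zero_iff two_ne_zero |>.mp hsq)

theorem ray_in_product_with_compact_factor {N M₁ : Type*}
    [MetricSpace N] [CompactSpace N] [MetricSpace M₁]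
    (γ : ℝ → WithLp 2 (N × M₁))
    (hγ : ∀ s t : ℝ, 0 ≤ s → 0 ≤ t → dist (γ s) (γ t) = |s - t|) :
    (∀ s : ℝ, 0 ≤ s → (WithLp.equiv 2 (N × M₁) (γ s)).1 = (WithLp.equiv 2 (N × M₁) (γ 0)).1) ∧
    (∀ s t : ℝ, 0 ≤ s → 0 ≤ t →
      dist (WithLp.equiv 2 (N × M₁) (γ s)).2 (WithLp.equiv 2 (N × M₁) (γ t)).2 = |s - t|) := by
  change (∀ s : ℝ, 0 ≤ s → (γ s).fst = (γ 0).fst) ∧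
    (∀ s t : ℝ, 0 ≤ s → 0 ≤ t → dist (γ s).snd (γ t).snd = |s - t|)
  have hsq : ∀ s t : ℝ, 0 ≤ s → 0 ≤ t →
      (t - s) ^ 2 = dist (γ s).fst (γ t).fst ^ 2 + dist (γ s).snd (γ t).snd ^ 2 := by
    intro s t hs ht
    rw [← WithLp.dist_sq_eq_of_L2, hγ s t hs ht, sq_abs, sub_sq_comm]
  have hconst : ∀ s : ℝ, 0 ≤ s → (γ s).fst = (γ 0).fst := by
    intro s hs
    by_contra hne
    have hpos : 0 < dist (γ 0).fst (γ s).fst := dist_pos.mpr (Ne.symm hne)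
    set D := Metric.diam (Set.univ : Set N)
    have hD : 0 ≤ D := Metric.diam_nonneg
    set q := (s * D + 1) / dist (γ 0).fst (γ s).fst with hq_def
    have hq : 0 ≤ q := by positivity
    have hsq' : 0 ≤ s + q := add_nonneg hs hq
    have hprop : q * dist (γ 0).fst (γ s).fst = s * dist (γ s).fst (γ (s + q)).fst :=
      mul_eq_mul_of_minkowski_eq hs hq dist_nonneg dist_nonneg
        (dist_triangle (γ 0).fst (γ s).fst (γ (s + q)).fst)
        (dist_triangle (γ 0).snd (γ s).snd (γ (s + q)).snd)
        (by simpa using hsq 0 s le_rfl hs) (by simpa using hsq s (s + q) hs hsq')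
        (by simpa using hsq 0 (s + q) le_rfl hsq')
    rw [hq_def, div_mul_cancel₀ _ hpos.ne', ← hq_def] at hprop
    have hle : dist (γ s).fst (γ (s + q)).fst ≤ D :=
      Metric.dist_le_diam_of_mem isCompact_univ.isBounded (Set.mem_univ _) (Set.mem_univ _)
    linarith [mul_le_mul_of_nonneg_left hle hs]
  refine ⟨hconst, fun s t hs ht => ?_⟩
  have h := hsq s t hs ht
  rw [hconst s hs, hconst t ht, dist_self, zero_pow two_ne_zero, zero_add] at h
  rw [abs_sub_comm, ← abs_of_nonneg (dist_nonneg (x := (γ s).snd))]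
  exact (sq_eq_sq_iff_abs_eq_abs _ _).mp h.symm
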